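/- Assume (A1) and (A2). Let u be a positive classical solution on ℝ × [0,T*) with u(x,t) = u(1−x,t) for all (x,t) and with u_x extending continuously to ℝ × [0,T*) so that u_x(x,0) = g'(x); set v := u_x. Let a, b ∈ [0,1/2] with a < b, and let w : [a,b] × [0,T*) → ℝ be C², with w and w_x bounded on [a,b] × [0,T] for each T < T*, satisfying w_t ≤ w_xx/((u_x)² + 1) + f(x) w w_x/√((u_x)² + 1) − 2 w (w_x)²/((u_x)² + 1)² on (a,b) × (0,T*), w(a,t) = w(b,t) = 0 for all t ∈ [0,T*), and w(x,0) ≤ g'(x) for all x ∈ [a,b]. Then v(x,t) ≥ w(x,t) for all (x,t) ∈ [a,b] × [0,T*). -/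

import Mathlib

open Real Set Filter Topology

noncomputable section

/-- Partial derivative in the space variable `x`. -/
def pdx (u : ℝ → ℝ → ℝ) (x t : ℝ) : ℝ := deriv (fun y => u y t) x

/-- Second partial derivative in the space variable `x`. -/
def pdxx (u : ℝ → ℝ → ℝ) (x t : ℝ) : ℝ := deriv (fun y => pdx u y t) x

/-- Partial derivative in the time variable `t`. -/
def pdt (u : ℝ → ℝ → ℝ) (x t : ℝ) : ℝ := deriv (fun s => u x s) t

/-- Assumption (A1): `f` is `C¹`, `ℤ`-periodic and positive; `g` is `C²`, `ℤ`-periodic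
and positive. -/
def A1 (f g : ℝ → ℝ) : Prop :=
  ContDiff ℝ 1 f ∧ (∀ x, f (x + 1) = f x) ∧ (∀ x, 0 < f x) ∧
  ContDiff ℝ 2 g ∧ (∀ x, g (x + 1) = g x) ∧ (∀ x, 0 < g x)

/-- A positive classical solution of the scaled problem on `ℝ × [0, T)`, where
`T : EReal` with `0 < T ≤ ∞`:
`u_t = u_xx/((u_x)² + 1) − (n−1)/u + (1/ε) f(x) √((u_x)² + 1)`, `u(x,0) = ε^α g(x)`. -/
structure IsSol (n : ℕ) (f g : ℝ → ℝ) (ε α : ℝ) (T : EReal) (u : ℝ → ℝ → ℝ) : Prop where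
  pos : ∀ x t : ℝ, 0 ≤ t → (t : EReal) < T → 0 < u x t
  cont : ContinuousOn (fun p : ℝ × ℝ => u p.1 p.2)
    {p : ℝ × ℝ | 0 ≤ p.2 ∧ (p.2 : EReal) < T}
  smooth : ContDiffOn ℝ (⊤ : ℕ∞) (fun p : ℝ × ℝ => u p.1 p.2)
    {p : ℝ × ℝ | 0 < p.2 ∧ (p.2 : EReal) < T}
  periodic : ∀ x t : ℝ, u (x + 1) t = u x t
  eqn : ∀ x t : ℝ, 0 < t → (t : EReal) < T →
    pdt u x t = pdxx u x t / ((pdx u x t) ^ 2 + 1) - ((n : ℝ) - 1) / u x t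
      + (1 / ε) * f x * Real.sqrt ((pdx u x t) ^ 2 + 1)
  init : ∀ x : ℝ, u x 0 = ε ^ α * g x

/-- Assumption (A2): `f` and `g` are symmetric about `x = 1/2` on `[0,1]`, nondecreasing
on `[0,1/2]`, and `g(0) < g(1/2)`. -/
def A2 (f g : ℝ → ℝ) : Prop :=
  (∀ x ∈ Set.Icc (0 : ℝ) 1, f x = f (1 - x)) ∧
  (∀ x ∈ Set.Icc (0 : ℝ) 1, g x = g (1 - x)) ∧
  (∀ x ∈ Set.Icc (0 : ℝ) (1 / 2), 0 ≤ deriv f x) ∧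
  (∀ x ∈ Set.Icc (0 : ℝ) (1 / 2), 0 ≤ deriv g x) ∧
  g 0 < g (1 / 2)

/-- Second derivative test at a local maximum, in its necessary form. -/
lemma IsLocalMax.deriv_deriv_nonpos {h : ℝ → ℝ} {x : ℝ} (hm : IsLocalMax h x)
    (hc : ContinuousAt h x) : deriv (deriv h) x ≤ 0 := by
  by_contra! hpos
  have hmin := isLocalMin_of_deriv_deriv_pos hpos hm.deriv_eq_zero hc
  have heq : h =ᶠ[𝓝 x] fun _ => h x := by
    filter_upwards [hm, hmin] with y h1 h2 using le_antisymm h1 h2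
  have h0 : deriv (deriv h) x = 0 := by
    rw [heq.deriv.deriv_eq]
    simp
  exact hpos.ne' h0

/-- The derivative is nonnegative at a point which maximizes the function from the left. -/
lemma HasDerivAt.nonneg_of_le_left {h : ℝ → ℝ} {h' c t : ℝ} (hd : HasDerivAt h h' t)
    (hct : c < t) (hle : ∀ s ∈ Ioo c t, h s ≤ h t) : 0 ≤ h' := by
  have hs := (hasDerivAt_iff_tendsto_slope_left_right.1 hd).1
  refine ge_of_tendsto hs ?_
  filter_upwards [Ioo_mem_nhdsLT hct] with s hst
  rw [slope_def_field]
  exact div_nonneg_of_nonpos (by linarith [hle s hst]) (by linarith [hst.2])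

/-- Parabolic weak maximum principle on a rectangle: a function whose time derivative is at most
`K` times the function at each positive interior spatial maximum, and which is nonpositive on the
parabolic boundary, is nonpositive. -/
lemma parabolic_max_principle {z : ℝ → ℝ → ℝ} {a b T K : ℝ}
    (hc : ContinuousOn (fun p : ℝ × ℝ => z p.1 p.2) (Icc a b ×ˢ Icc 0 T))
    (ha : ∀ t ∈ Icc 0 T, z a t ≤ 0) (hb : ∀ t ∈ Icc 0 T, z b t ≤ 0)
    (h0 : ∀ x ∈ Icc a b, z x 0 ≤ 0)
    (hd : ∀ x ∈ Ioo a b, ∀ t ∈ Ioc 0 T, DifferentiableAt ℝ (fun s => z x s) t)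
    (hsub : ∀ x ∈ Ioo a b, ∀ t ∈ Ioc 0 T, 0 < z x t → pdx z x t = 0 → pdxx z x t ≤ 0 →
      pdt z x t ≤ K * z x t) :
    ∀ x ∈ Icc a b, ∀ t ∈ Icc 0 T, z x t ≤ 0 := by
  intro x hx t ht
  by_contra! hpos
  obtain ⟨⟨y, s⟩, ⟨hy, hs⟩, hmax⟩ := (isCompact_Icc.prod isCompact_Icc).exists_isMaxOn
    (⟨(x, t), hx, ht⟩ : (Icc a b ×ˢ Icc (0 : ℝ) T).Nonempty)
    (f := fun p : ℝ × ℝ => Real.exp (-(K + 1) * p.2) * z p.1 p.2)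
    ((by fun_prop : Continuous fun p : ℝ × ℝ => Real.exp (-(K + 1) * p.2)).continuousOn.mul hc)
  have hmax' : ∀ y' ∈ Icc a b, ∀ s' ∈ Icc 0 T,
      Real.exp (-(K + 1) * s') * z y' s' ≤ Real.exp (-(K + 1) * s) * z y s :=
    fun y' hy' s' hs' => hmax (⟨hy', hs'⟩ : (y', s') ∈ Icc a b ×ˢ Icc 0 T)
  have hz : 0 < z y s :=
    pos_of_mul_pos_right ((mul_pos (Real.exp_pos _) hpos).trans_le (hmax' x hx t ht))
      (Real.exp_pos _).le
  have hy' : y ∈ Ioo a b := by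
    refine ⟨lt_of_le_of_ne hy.1 ?_, lt_of_le_of_ne hy.2 ?_⟩
    · rintro rfl
      exact (ha s hs).not_gt hz
    · rintro rfl
      exact (hb s hs).not_gt hz
  have hs' : s ∈ Ioc 0 T := by
    refine ⟨lt_of_le_of_ne hs.1 ?_, hs.2⟩
    rintro rfl
    exact (h0 y hy).not_gt hz
  have hloc : IsLocalMax (fun y => z y s) y := by
    filter_upwards [Icc_mem_nhds hy'.1 hy'.2] with y' h'
    exact le_of_mul_le_mul_left (hmax' y' h' s hs) (Real.exp_pos _)
  have hcy : ContinuousAt (fun y => z y s) y := by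
    refine ContinuousOn.continuousAt (s := Icc a b) ?_ (Icc_mem_nhds hy'.1 hy'.2)
    exact hc.comp (f := fun y => (y, s)) (by fun_prop) fun y' h' => ⟨h', hs⟩
  have key := hsub y hy' s hs' hz hloc.deriv_eq_zero (hloc.deriv_deriv_nonpos hcy)
  have hzt : HasDerivAt (fun r => z y r) (pdt z y s) s := (hd y hy' s hs').hasDerivAt
  have hexp : HasDerivAt (fun r => Real.exp (-(K + 1) * r))
      (Real.exp (-(K + 1) * s) * (-(K + 1) * 1)) s :=
    ((hasDerivAt_id s).const_mul (-(K + 1))).exp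
  have hnn := (hexp.mul hzt).nonneg_of_le_left hs'.1 fun r hr =>
    hmax' y hy r ⟨hr.1.le, hr.2.le.trans hs.2⟩
  have hfac : 0 ≤ Real.exp (-(K + 1) * s) * (pdt z y s - (K + 1) * z y s) := by
    linarith
  have := nonneg_of_mul_nonneg_right hfac (Real.exp_pos _)
  linarith

lemma hasDerivAt_fderiv_fst {u : ℝ → ℝ → ℝ} {x t : ℝ}
    (h : DifferentiableAt ℝ (fun p : ℝ × ℝ => u p.1 p.2) (x, t)) :
    HasDerivAt (fun y => u y t) (fderiv ℝ (fun p : ℝ × ℝ => u p.1 p.2) (x, t) (1, 0)) x :=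
  h.hasFDerivAt.comp_hasDerivAt (f := fun y : ℝ => (y, t)) x
    ((hasDerivAt_id x).prodMk (hasDerivAt_const x t))

lemma hasDerivAt_fderiv_snd {u : ℝ → ℝ → ℝ} {x t : ℝ}
    (h : DifferentiableAt ℝ (fun p : ℝ × ℝ => u p.1 p.2) (x, t)) :
    HasDerivAt (fun s => u x s) (fderiv ℝ (fun p : ℝ × ℝ => u p.1 p.2) (x, t) (0, 1)) t :=
  h.hasFDerivAt.comp_hasDerivAt (f := fun s : ℝ => (x, s)) t
    ((hasDerivAt_const t x).prodMk (hasDerivAt_id t))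

lemma hasDerivAt_pdx {u : ℝ → ℝ → ℝ} {x t : ℝ}
    (h : DifferentiableAt ℝ (fun p : ℝ × ℝ => u p.1 p.2) (x, t)) :
    HasDerivAt (fun y => u y t) (pdx u x t) x :=
  (hasDerivAt_fderiv_fst h).differentiableAt.hasDerivAt

lemma hasDerivAt_pdt {u : ℝ → ℝ → ℝ} {x t : ℝ}
    (h : DifferentiableAt ℝ (fun p : ℝ × ℝ => u p.1 p.2) (x, t)) :
    HasDerivAt (fun s => u x s) (pdt u x t) t :=
  (hasDerivAt_fderiv_snd h).differentiableAt.hasDerivAt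

lemma pdx_eventuallyEq {u : ℝ → ℝ → ℝ} {p : ℝ × ℝ}
    (h : ContDiffAt ℝ 1 (fun p : ℝ × ℝ => u p.1 p.2) p) :
    (fun q : ℝ × ℝ => pdx u q.1 q.2) =ᶠ[𝓝 p]
      fun q => fderiv ℝ (fun p : ℝ × ℝ => u p.1 p.2) q (1, 0) := by
  filter_upwards [h.eventually (by simp)] with q hq
  exact (hasDerivAt_fderiv_fst (hq.differentiableAt one_ne_zero)).deriv

lemma pdt_eventuallyEq {u : ℝ → ℝ → ℝ} {p : ℝ × ℝ}
    (h : ContDiffAt ℝ 1 (fun p : ℝ × ℝ => u p.1 p.2) p) :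
    (fun q : ℝ × ℝ => pdt u q.1 q.2) =ᶠ[𝓝 p]
      fun q => fderiv ℝ (fun p : ℝ × ℝ => u p.1 p.2) q (0, 1) := by
  filter_upwards [h.eventually (by simp)] with q hq
  exact (hasDerivAt_fderiv_snd (hq.differentiableAt one_ne_zero)).deriv

lemma contDiffAt_pdx {u : ℝ → ℝ → ℝ} {p : ℝ × ℝ} {m : ℕ}
    (h : ContDiffAt ℝ (m + 1) (fun p : ℝ × ℝ => u p.1 p.2) p) :
    ContDiffAt ℝ m (fun q : ℝ × ℝ => pdx u q.1 q.2) p :=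
  ((h.fderiv_right le_rfl).clm_apply contDiffAt_const).congr_of_eventuallyEq
    (pdx_eventuallyEq (h.of_le (by simp)))

lemma contDiffAt_pdt {u : ℝ → ℝ → ℝ} {p : ℝ × ℝ} {m : ℕ}
    (h : ContDiffAt ℝ (m + 1) (fun p : ℝ × ℝ => u p.1 p.2) p) :
    ContDiffAt ℝ m (fun q : ℝ × ℝ => pdt u q.1 q.2) p :=
  ((h.fderiv_right le_rfl).clm_apply contDiffAt_const).congr_of_eventuallyEq
    (pdt_eventuallyEq (h.of_le (by simp)))

/-- Mixed partial derivatives of a `C²` function commute. -/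
lemma pdx_pdt_comm {u : ℝ → ℝ → ℝ} {x t : ℝ}
    (h : ContDiffAt ℝ 2 (fun p : ℝ × ℝ => u p.1 p.2) (x, t)) :
    pdx (pdt u) x t = pdt (pdx u) x t := by
  have h1 : ContDiffAt ℝ 1 (fun p : ℝ × ℝ => u p.1 p.2) (x, t) := h.of_le (by norm_num)
  have h2 : ContDiffAt ℝ ((1 : ℕ) + 1) (fun p : ℝ × ℝ => u p.1 p.2) (x, t) :=
    h.of_le (by norm_num)
  have hF : DifferentiableAt ℝ (fderiv ℝ (fun p : ℝ × ℝ => u p.1 p.2)) (x, t) :=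
    (h2.fderiv_right le_rfl).differentiableAt (by simp)
  have e1 : pdx (pdt u) x t = _ :=
    (hasDerivAt_fderiv_fst ((contDiffAt_pdt h2).differentiableAt (by simp))).deriv
  have e2 : pdt (pdx u) x t = _ :=
    (hasDerivAt_fderiv_snd ((contDiffAt_pdx h2).differentiableAt (by simp))).deriv
  rw [e1, e2, (pdt_eventuallyEq h1).fderiv_eq, (pdx_eventuallyEq h1).fderiv_eq,
    fderiv_clm_apply hF (differentiableAt_const _), fderiv_clm_apply hF (differentiableAt_const _)]
  have hsymm := h.isSymmSndFDerivAt (by simp)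
  simpa using hsymm (1, 0) (0, 1)

lemma IsSol.contDiffAt {n : ℕ} {f g : ℝ → ℝ} {ε α : ℝ} {T : ℝ} {u : ℝ → ℝ → ℝ}
    (hu : IsSol n f g ε α (T : EReal) u) {x t : ℝ} (ht : 0 < t) (htT : t < T) :
    ContDiffAt ℝ (⊤ : ℕ∞) (fun p : ℝ × ℝ => u p.1 p.2) (x, t) := by
  refine hu.smooth.contDiffAt (IsOpen.mem_nhds ?_ ⟨ht, EReal.coe_lt_coe_iff.2 htT⟩)
  simp only [EReal.coe_lt_coe_iff]
  exact (isOpen_lt continuous_const continuous_snd).inter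
    (isOpen_lt continuous_snd continuous_const)

/-- The evolution equation of `u_x`. -/
lemma IsSol.pdt_pdx {n : ℕ} {f g : ℝ → ℝ} {ε α : ℝ} {T : ℝ} {u : ℝ → ℝ → ℝ}
    (hf : Differentiable ℝ f) (hu : IsSol n f g ε α (T : EReal) u) {x t : ℝ}
    (ht : 0 < t) (htT : t < T) :
    pdt (pdx u) x t = pdxx (pdx u) x t / ((pdx u x t) ^ 2 + 1)
      - 2 * pdx u x t * (pdx (pdx u) x t) ^ 2 / ((pdx u x t) ^ 2 + 1) ^ 2
      + ((n : ℝ) - 1) * pdx u x t / (u x t) ^ 2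
      + 1 / ε * deriv f x * √((pdx u x t) ^ 2 + 1)
      + 1 / ε * f x * pdx u x t * pdx (pdx u) x t / √((pdx u x t) ^ 2 + 1) := by
  have hC := hu.contDiffAt (x := x) ht htT
  have hC0 : ContDiffAt ℝ ((2 : ℕ) + 1) (fun p : ℝ × ℝ => u p.1 p.2) (x, t) :=
    mod_cast contDiffAt_infty.1 hC 3
  have hC1 : ContDiffAt ℝ ((1 : ℕ) + 1) (fun p : ℝ × ℝ => pdx u p.1 p.2) (x, t) :=
    contDiffAt_pdx hC0
  have hC2 := contDiffAt_pdx hC1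
  have d0 := hasDerivAt_pdx (hC0.differentiableAt (by simp))
  have d1 := hasDerivAt_pdx (hC1.differentiableAt (by simp))
  have d2 : HasDerivAt (fun y => pdxx u y t) (pdxx (pdx u) x t) x :=
    hasDerivAt_pdx (hC2.differentiableAt (by simp))
  have hu0 : u x t ≠ 0 := (hu.pos x t ht.le (EReal.coe_lt_coe_iff.2 htT)).ne'
  have hD : (pdx u x t) ^ 2 + 1 ≠ 0 := by positivity
  have dD := (d1.pow 2).add_const 1
  have hs : √((pdx u x t) ^ 2 + 1) ≠ 0 := by positivity
  have d := ((d2.div dD hD).sub ((hasDerivAt_const x ((n : ℝ) - 1)).div d0 hu0)).add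
    (((hf x).hasDerivAt.const_mul (1 / ε)).mul (dD.sqrt hD))
  have e : (fun y => pdt u y t) = _ :=
    funext fun y => hu.eqn y t ht (EReal.coe_lt_coe_iff.2 htT)
  rw [← pdx_pdt_comm (contDiffAt_infty.1 hC 2), pdx, e]
  refine d.deriv.trans ?_
  have e2 : pdxx u x t = pdx (pdx u) x t := rfl
  simp only [Pi.pow_apply, e2]
  field_simp
  ring

/-- Lemma 4.2: under (A1), (A2), let `u` be a symmetric positive classical
solution on `ℝ × [0,T*)` (equation with `ε = 1`) with `u_x` extending continuously to
`t = 0` with value `g'`, and set `v := u_x`. If `w` is `C²` on `[a,b] × [0,T*)`, with `w`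
and `w_x` bounded on `[a,b] × [0,T]` for each `T < T*`, satisfying the differential
inequality of a subsolution on `(a,b) × (0,T*)`, vanishing on the lateral boundary, and
`w(·,0) ≤ g'` on `[a,b]`, then `v ≥ w` on `[a,b] × [0,T*)`. -/
theorem subsolution_comparison_for_ux (n : ℕ) (hn : 2 ≤ n) (f g : ℝ → ℝ)
    (hA1 : A1 f g) (hA2 : A2 f g)
    (Ts : ℝ) (hTs : 0 < Ts) (u : ℝ → ℝ → ℝ)
    (hu : IsSol n f g 1 1 (Ts : EReal) u)
    (hsym : ∀ x t : ℝ, 0 ≤ t → t < Ts → u x t = u (1 - x) t)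
    (huxcont : ContinuousOn (fun p : ℝ × ℝ => pdx u p.1 p.2)
      {p : ℝ × ℝ | 0 ≤ p.2 ∧ p.2 < Ts})
    (huxinit : ∀ x : ℝ, pdx u x 0 = deriv g x)
    (a b : ℝ) (ha : a ∈ Set.Icc (0 : ℝ) (1 / 2)) (hb : b ∈ Set.Icc (0 : ℝ) (1 / 2))
    (hab : a < b) (w : ℝ → ℝ → ℝ)
    (hwC2 : ContDiffOn ℝ 2 (fun p : ℝ × ℝ => w p.1 p.2)
      (Set.Icc a b ×ˢ Set.Ico 0 Ts))
    (hwbdd : ∀ T : ℝ, 0 ≤ T → T < Ts → ∃ Cb : ℝ,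
      ∀ x ∈ Set.Icc a b, ∀ t ∈ Set.Icc (0 : ℝ) T, |w x t| ≤ Cb ∧ |pdx w x t| ≤ Cb)
    (hwsub : ∀ x t : ℝ, a < x → x < b → 0 < t → t < Ts →
      pdt w x t ≤ pdxx w x t / ((pdx u x t) ^ 2 + 1)
        + f x * w x t * pdx w x t / Real.sqrt ((pdx u x t) ^ 2 + 1)
        - 2 * w x t * (pdx w x t) ^ 2 / ((pdx u x t) ^ 2 + 1) ^ 2)
    (hwbc : ∀ t : ℝ, 0 ≤ t → t < Ts → w a t = 0 ∧ w b t = 0)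
    (hwinit : ∀ x ∈ Set.Icc a b, w x 0 ≤ deriv g x) :
    ∀ x ∈ Set.Icc a b, ∀ t : ℝ, 0 ≤ t → t < Ts → w x t ≤ pdx u x t := by
  obtain ⟨hf, -, hfpos, -⟩ := hA1
  obtain ⟨-, -, hf', hg', -⟩ := hA2
  have hfd : Differentiable ℝ f := hf.differentiable one_ne_zero
  have hn1 : (0 : ℝ) ≤ (n : ℝ) - 1 := by
    have : (2 : ℝ) ≤ n := by exact_mod_cast hn
    linarith
  have hv0 : ∀ t, 0 ≤ t → t < Ts → pdx u 0 t = 0 := by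
    intro t h0 h1
    have e : (fun y => u y t) = fun y => u (-y) t := by
      funext y
      rw [hsym y t h0 h1, ← hu.periodic (-y) t]
      ring_nf
    have h : pdx u 0 t = -pdx u 0 t := by
      conv_lhs => rw [pdx, e]
      rw [deriv_comp_neg (fun y => u y t), neg_zero, pdx]
    linarith
  have hv1 : ∀ t, 0 ≤ t → t < Ts → pdx u (1 / 2) t = 0 := by
    intro t h0 h1
    have e : (fun y => u y t) = fun y => u (1 - y) t := funext fun y => hsym y t h0 h1
    have h : pdx u (1 / 2) t = -pdx u (1 / 2) t := by
      conv_lhs => rw [pdx, e]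
      rw [deriv_comp_const_sub (f := fun y => u y t), pdx]
      norm_num
    linarith
  have hvC : ∀ x t, 0 < t → t < Ts →
      ContDiffAt ℝ ((1 : ℕ) + 1) (fun p : ℝ × ℝ => pdx u p.1 p.2) (x, t) := by
    intro x t h0 h1
    exact contDiffAt_pdx (m := 2) (mod_cast contDiffAt_infty.1 (hu.contDiffAt h0 h1) 3)
  have hv : ∀ x ∈ Icc (0 : ℝ) (1 / 2), ∀ t, 0 ≤ t → t < Ts → 0 ≤ pdx u x t := by
    intro x hx T h0 h1
    have hucont : ContinuousOn (fun p : ℝ × ℝ => u p.1 p.2)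
        (Icc (0 : ℝ) (1 / 2) ×ˢ Icc 0 T) :=
      hu.cont.mono fun p hp => ⟨hp.2.1, EReal.coe_lt_coe_iff.2 (hp.2.2.trans_lt h1)⟩
    obtain ⟨q, hq, hmin⟩ := (isCompact_Icc.prod isCompact_Icc).exists_isMinOn
      (⟨(x, T), hx, h0, le_rfl⟩ : (Icc (0 : ℝ) (1 / 2) ×ˢ Icc 0 T).Nonempty) hucont
    have hm : 0 < u q.1 q.2 :=
      hu.pos _ _ hq.2.1 (EReal.coe_lt_coe_iff.2 (hq.2.2.trans_lt h1))
    have main := parabolic_max_principle (z := fun x t => -pdx u x t) (a := 0) (b := 1 / 2)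
      (T := T) (K := ((n : ℝ) - 1) / (u q.1 q.2) ^ 2)
      (huxcont.mono fun p hp => ⟨hp.2.1, hp.2.2.trans_lt h1⟩).neg
      (fun t ht => by simp [hv0 t ht.1 (ht.2.trans_lt h1)])
      (fun t ht => by simp [-one_div, hv1 t ht.1 (ht.2.trans_lt h1)])
      (fun y hy => by simpa [huxinit] using hg' y hy)
      (fun y _ t ht => (hasDerivAt_pdt
        ((hvC y t ht.1 (ht.2.trans_lt h1)).differentiableAt (by simp))).differentiableAt.neg)
      ?_ x hx T ⟨h0, le_rfl⟩
    · simpa using main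
    intro y hy t ht hpos hx0 hxx
    have htT := ht.2.trans_lt h1
    have e1 : ∀ y, pdx (fun x t => -pdx u x t) y t = -pdx (pdx u) y t := fun y => deriv.fun_neg
    have e2 : pdxx (fun x t => -pdx u x t) y t = -pdxx (pdx u) y t := by
      simp only [pdxx, e1]
      exact deriv.fun_neg
    have e3 : pdt (fun x t => -pdx u x t) y t = -pdt (pdx u) y t := deriv.fun_neg
    rw [e1] at hx0
    rw [e2] at hxx
    have hyI : y ∈ Icc (0 : ℝ) (1 / 2) := ⟨hy.1.le, hy.2.le⟩
    have hle : u q.1 q.2 ≤ u y t :=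
      hmin (⟨hyI, ht.1.le, ht.2⟩ : (y, t) ∈ Icc (0 : ℝ) (1 / 2) ×ˢ Icc 0 T)
    rw [e3, hu.pdt_pdx hfd ht.1 htT, neg_eq_zero.1 hx0]
    have t1 : 0 ≤ pdxx (pdx u) y t / ((pdx u y t) ^ 2 + 1) :=
      div_nonneg (by linarith) (by positivity)
    have t2 : 0 ≤ deriv f y * √((pdx u y t) ^ 2 + 1) :=
      mul_nonneg (hf' y hyI) (Real.sqrt_nonneg _)
    have t3 : ((n : ℝ) - 1) / (u y t) ^ 2 * -pdx u y t
        ≤ ((n : ℝ) - 1) / (u q.1 q.2) ^ 2 * -pdx u y t := by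
      gcongr
    have t4 : ((n : ℝ) - 1) * pdx u y t / (u y t) ^ 2
        = -(((n : ℝ) - 1) / (u y t) ^ 2 * -pdx u y t) := by ring
    rw [t4]
    norm_num
    norm_num at t1 t2 t3
    linarith
  intro x hx T h0 h1
  obtain ⟨C, hC⟩ := hwbdd T h0 h1
  obtain ⟨F, hF⟩ := isCompact_Icc.exists_bound_of_continuousOn
    (hf.continuous.continuousOn (s := Icc a b))
  have hsubI : Icc a b ⊆ Icc (0 : ℝ) (1 / 2) := Icc_subset_Icc ha.1 hb.2
  have hwC : ∀ x ∈ Ioo a b, ∀ t ∈ Ioo 0 Ts,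
      ContDiffAt ℝ ((1 : ℕ) + 1) (fun p : ℝ × ℝ => w p.1 p.2) (x, t) := by
    intro x hx t ht
    refine (hwC2.contDiffAt (prod_mem_nhds (Icc_mem_nhds hx.1 hx.2)
      (Ico_mem_nhds ht.1 ht.2))).of_le (by norm_num)
  have main := parabolic_max_principle (z := fun x t => w x t - pdx u x t) (a := a) (b := b)
    (T := T) (K := F * C)
    ((hwC2.continuousOn.mono fun p hp => ⟨hp.1, hp.2.1, hp.2.2.trans_lt h1⟩).sub
      (huxcont.mono fun p hp => ⟨hp.2.1, hp.2.2.trans_lt h1⟩))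
    (fun t ht => by
      have htT := ht.2.trans_lt h1
      simpa [(hwbc t ht.1 htT).1] using hv a ha t ht.1 htT)
    (fun t ht => by
      have htT := ht.2.trans_lt h1
      simpa [(hwbc t ht.1 htT).2] using hv b hb t ht.1 htT)
    (fun y hy => by simpa [huxinit] using hwinit y hy)
    (fun y hy t ht => (hasDerivAt_pdt ((hwC y hy t ⟨ht.1, ht.2.trans_lt h1⟩).differentiableAt
        (by simp))).differentiableAt.sub (hasDerivAt_pdt
        ((hvC y t ht.1 (ht.2.trans_lt h1)).differentiableAt (by simp))).differentiableAt)
    ?_ x hx T ⟨h0, le_rfl⟩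
  · linarith
  intro y hy t ht hpos hx0 hxx
  have htT := ht.2.trans_lt h1
  have hyI : y ∈ Icc a b := ⟨hy.1.le, hy.2.le⟩
  have dw := fun y (hy : y ∈ Ioo a b) => (hwC y hy t ⟨ht.1, htT⟩)
  have dv := fun y => (hvC y t ht.1 htT)
  have e1 : ∀ y ∈ Ioo a b,
      pdx (fun x t => w x t - pdx u x t) y t = pdx w y t - pdx (pdx u) y t := fun y hy =>
    ((hasDerivAt_pdx ((dw y hy).differentiableAt (by simp))).sub
      (hasDerivAt_pdx ((dv y).differentiableAt (by simp)))).deriv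
  have e2 : pdxx (fun x t => w x t - pdx u x t) y t = pdxx w y t - pdxx (pdx u) y t := by
    have e : (fun y => pdx (fun x t => w x t - pdx u x t) y t)
        =ᶠ[𝓝 y] fun y => pdx w y t - pdx (pdx u) y t := by
      filter_upwards [Ioo_mem_nhds hy.1 hy.2] with y' hy' using e1 y' hy'
    rw [pdxx, e.deriv_eq]
    exact ((hasDerivAt_pdx ((contDiffAt_pdx (dw y hy)).differentiableAt (by simp))).sub
      (hasDerivAt_pdx ((contDiffAt_pdx (dv y)).differentiableAt (by simp)))).deriv
  have e3 : pdt (fun x t => w x t - pdx u x t) y t = pdt w y t - pdt (pdx u) y t :=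
    ((hasDerivAt_pdt ((dw y hy).differentiableAt (by simp))).sub
      (hasDerivAt_pdt ((dv y).differentiableAt (by simp)))).deriv
  rw [e1 y hy, sub_eq_zero] at hx0
  rw [e2] at hxx
  rw [e3, hu.pdt_pdx hfd ht.1 htT, ← hx0]
  have hw := hwsub y t hy.1 hy.2 ht.1 htT
  have hvy := hv y (hsubI hyI) t ht.1.le htT
  have hfy := hf' y (hsubI hyI)
  have hFy : f y ≤ F := (le_abs_self _).trans (hF y hyI)
  have hCy := (hC y hyI t ⟨ht.1.le, ht.2⟩).2
  have hfp := hfpos y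
  generalize pdx w y t = p at *
  generalize pdx u y t = v at *
  generalize w y t = W at *
  set D := v ^ 2 + 1 with hD
  have hD1 : 1 ≤ √D := Real.one_le_sqrt.2 (by nlinarith [sq_nonneg v])
  have t1 : (pdxx w y t - pdxx (pdx u) y t) / D ≤ 0 :=
    div_nonpos_of_nonpos_of_nonneg hxx (by positivity)
  have t2 : 0 ≤ ((n : ℝ) - 1) * v / (u y t) ^ 2 := by positivity
  have t3 : 0 ≤ deriv f y * √D := by positivity
  have t4 : 0 ≤ 2 * (W - v) * p ^ 2 / D ^ 2 := by positivity
  have t5 : f y * (W - v) * p / √D ≤ F * C * (W - v) := by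
    have : f y * p / √D ≤ F * C :=
      calc f y * p / √D ≤ f y * |p| / √D := by gcongr; exact le_abs_self p
        _ ≤ f y * |p| := div_le_self (by positivity) hD1
        _ ≤ F * C := mul_le_mul hFy hCy (abs_nonneg p) (hfp.le.trans hFy)
    calc f y * (W - v) * p / √D = f y * p / √D * (W - v) := by ring
      _ ≤ _ := mul_le_mul_of_nonneg_right this hpos.le
  have expand : f y * (W - v) * p / √D = f y * W * p / √D - f y * v * p / √D := by ring
  have expand' : 2 * (W - v) * p ^ 2 / D ^ 2 = 2 * W * p ^ 2 / D ^ 2 - 2 * v * p ^ 2 / D ^ 2 := by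
    ring
  rw [sub_div] at t1
  rw [div_one, one_mul, one_mul]
  linarith
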